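/- Concentration of the information density for parity-check ensembles: with γ = (1/n) I(S;Y^n) + ε for ε > 0, the probability P(i(S;Y^n) > nγ) ≤ exp(−2nε²/d), where d = (log₂(β_{q,w} β_q β_t))² and i(s;y^n) = log( p_{S,Y^n}(s,y^n) / (p_S(s) t^n(y^n)) ). -/

import Mathlib

/-- `p_S(s) = ∑_{xⁿ : xⁿHᵀ = s} qⁿ(xⁿ)` for the parity-check ensemble. -/
noncomputable def pS {r n : ℕ} (H : Matrix (Fin r) (Fin n) (ZMod 2))
    (q : ZMod 2 → ℝ) (s : Fin r → ZMod 2) : ℝ :=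
  ∑ z : Fin n → ZMod 2, if H.mulVec z = s then ∏ j, q (z j) else 0

/-- `p_{S,Yⁿ}(s,yⁿ) = ∑_{xⁿ : xⁿHᵀ = s} qⁿ(xⁿ) wⁿ(yⁿ|xⁿ)`. -/
noncomputable def pSY {Y : Type*} [Fintype Y] {r n : ℕ}
    (H : Matrix (Fin r) (Fin n) (ZMod 2)) (q : ZMod 2 → ℝ) (w : ZMod 2 → Y → ℝ)
    (s : Fin r → ZMod 2) (y : Fin n → Y) : ℝ :=
  ∑ z : Fin n → ZMod 2,
    if H.mulVec z = s then (∏ j, q (z j)) * ∏ j, w (z j) (y j) else 0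

/-- `tⁿ(yⁿ) = ∏ᵢ t(yᵢ)` with `t(y) = ∑_x q(x)w(y|x)`. -/
noncomputable def tn {Y : Type*} [Fintype Y] {n : ℕ}
    (q : ZMod 2 → ℝ) (w : ZMod 2 → Y → ℝ) (y : Fin n → Y) : ℝ :=
  ∏ j, ∑ a, q a * w a (y j)

/-- Information density `i(s;yⁿ) = log₂( p_{S,Yⁿ}(s,yⁿ) / (p_S(s) tⁿ(yⁿ)) )`. -/
noncomputable def infoDens {Y : Type*} [Fintype Y] {r n : ℕ}
    (H : Matrix (Fin r) (Fin n) (ZMod 2)) (q : ZMod 2 → ℝ) (w : ZMod 2 → Y → ℝ)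
    (s : Fin r → ZMod 2) (y : Fin n → Y) : ℝ :=
  Real.logb 2 (pSY H q w s y / (pS H q s * tn q w y))

/-- `I(S;Yⁿ) = E[i(S;Yⁿ)]`, the mutual information, where `S = XⁿHᵀ` with
`Xⁿ ∼ qⁿ` and `Yⁿ` the memoryless channel output. -/
noncomputable def mutInfoSY {Y : Type*} [Fintype Y] {r n : ℕ}
    (H : Matrix (Fin r) (Fin n) (ZMod 2)) (q : ZMod 2 → ℝ)
    (w : ZMod 2 → Y → ℝ) : ℝ :=
  ∑ x : Fin n → ZMod 2, ∑ y : Fin n → Y,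
    ((∏ j, q (x j)) * ∏ j, w (x j) (y j)) * infoDens H q w (H.mulVec x) y

theorem aux_hoeffding {Ω : Type*} [Fintype Ω] (p : Ω → ℝ) (hp0 : ∀ u, 0 ≤ p u)
    (hp1 : ∑ u, p u = 1) (c : ℝ) (g : Ω → ℝ)
    (hg : ∀ u v, 0 < p u → 0 < p v → |g u - g v| ≤ c) :
    ∑ u, p u * Real.exp (g u - ∑ v, p v * g v) ≤ Real.exp (c ^ 2 / 8) := by
  classical
  let _ : MeasurableSpace Ω := ⊤
  let P : PMF Ω := PMF.ofFintype (fun u => ENNReal.ofReal (p u)) (by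
    rw [← ENNReal.ofReal_sum_of_nonneg (fun u _ => hp0 u), hp1, ENNReal.ofReal_one])
  have hP : ∀ u, (P u).toReal = p u := fun u => by
    simp [P, PMF.ofFintype_apply, ENNReal.toReal_ofReal (hp0 u)]
  obtain ⟨u₀, hu₀⟩ : ∃ u, 0 < p u := by
    by_contra h
    push Not at h
    have : ∑ u, p u ≤ 0 := Finset.sum_nonpos fun u _ => h u
    linarith
  obtain ⟨m, hm, hmin⟩ := Finset.exists_min_image (Finset.univ.filter fun u => 0 < p u) g
    ⟨u₀, by simpa using hu₀⟩
  simp only [Finset.mem_filter, Finset.mem_univ, true_and] at hm hmin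
  have hae : ∀ᵐ ω ∂P.toMeasure, g ω ∈ Set.Icc (g m) (g m + c) := by
    rw [MeasureTheory.ae_iff, PMF.toMeasure_apply_eq_zero_iff _ (by trivial)]
    rw [Set.disjoint_left]
    intro u hu hbad
    apply hbad
    have hu' : 0 < p u := by
      rcases (hp0 u).lt_or_eq with h | h
      · exact h
      · exfalso
        rw [PMF.mem_support_iff] at hu
        apply hu
        simp [P, PMF.ofFintype_apply, ← h]
    refine ⟨hmin u hu', ?_⟩
    have := (abs_le.1 (hg u m hu' hm)).2
    linarith
  have h := ProbabilityTheory.hasSubgaussianMGF_of_mem_Icc (μ := P.toMeasure) (X := g)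
    (measurable_from_top.aemeasurable) hae
  have h1 := h.mgf_le 1
  rw [ProbabilityTheory.mgf] at h1
  simp only [PMF.integral_eq_sum, hP, smul_eq_mul, one_mul] at h1
  refine h1.trans (le_of_eq ?_)
  congr 1
  simp
  rw [div_pow, sq_abs]
  ring

theorem aux_mcd {Ω : Type*} [Fintype Ω] (κ : ℝ) : ∀ (n : ℕ) (p : Fin n → Ω → ℝ)
    (_ : ∀ i u, 0 ≤ p i u) (_ : ∀ i, ∑ u, p i u = 1) (c : Fin n → ℝ)
    (_ : ∀ i (g : Ω → ℝ), (∀ u v, 0 < p i u → 0 < p i v → |g u - g v| ≤ c i) →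
      ∑ u, p i u * Real.exp (g u - ∑ v, p i v * g v) ≤ Real.exp κ)
    (F : (Fin n → Ω) → ℝ)
    (_ : ∀ i ω v, (∀ j, 0 < p j (ω j)) → 0 < p i v →
      |F ω - F (Function.update ω i v)| ≤ c i),
    ∑ ω : Fin n → Ω, (∏ i, p i (ω i)) *
      Real.exp (F ω - ∑ ω' : Fin n → Ω, (∏ i, p i (ω' i)) * F ω') ≤ Real.exp (n * κ) := by
  intro n
  induction n with
  | zero => intro p _ _ c _ F _; simp
  | succ n ih =>
    intro p hp0 hp1 c hone F hF
    have hsum : ∀ f : (Fin (n+1) → Ω) → ℝ, ∑ ω, f ω = ∑ a, ∑ ω, f (Fin.cons a ω) := by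
      intro f
      rw [← (Fin.consEquiv (fun _ : Fin (n+1) => Ω)).sum_comp, Fintype.sum_prod_type]
      rfl
    set g : Ω → ℝ := fun a => ∑ ω : Fin n → Ω, (∏ i, p i.succ (ω i)) * F (Fin.cons a ω) with hgdef
    have hPs : ∑ ω : Fin n → Ω, ∏ i, p i.succ (ω i) = 1 := by
      rw [← Fintype.prod_sum (fun i : Fin n => p i.succ)]
      simp [hp1]
    have hEF : ∑ ω' : Fin (n+1) → Ω, (∏ i, p i (ω' i)) * F ω' = ∑ a, p 0 a * g a := by
      rw [hsum]
      refine Finset.sum_congr rfl fun a _ => ?_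
      rw [hgdef]
      simp only [Fin.prod_univ_succ, Fin.cons_zero, Fin.cons_succ, Finset.mul_sum, mul_assoc]
    rw [hEF, hsum]
    have hstep : ∀ a, ∑ ω : Fin n → Ω, (∏ i, p i ((Fin.cons a ω : Fin (n+1) → Ω) i)) *
        Real.exp (F (Fin.cons a ω) - ∑ a, p 0 a * g a)
        ≤ p 0 a * Real.exp (g a - ∑ a, p 0 a * g a) * Real.exp (n * κ) := by
      intro a
      rcases (hp0 0 a).lt_or_eq with h | h
      · have := ih (fun i => p i.succ) (fun i => hp0 _) (fun i => hp1 _) (fun i => c i.succ)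
          (fun i => hone _) (fun ω => F (Fin.cons a ω)) (by
            intro i ω v hω hv
            have := hF i.succ (Fin.cons a ω) v (by
              intro j
              refine Fin.cases ?_ (fun j => ?_) j
              · simpa using h
              · simpa using hω j) hv
            rwa [← Fin.cons_update] at this)
        calc _ = p 0 a * Real.exp (g a - ∑ a, p 0 a * g a) *
              ∑ ω : Fin n → Ω, (∏ i, p i.succ (ω i)) * Real.exp (F (Fin.cons a ω) - g a) := by
              rw [Finset.mul_sum]
              refine Finset.sum_congr rfl fun ω _ => ?_
              simp only [Fin.prod_univ_succ, Fin.cons_zero, Fin.cons_succ]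
              rw [show F (Fin.cons a ω) - ∑ a, p 0 a * g a =
                (g a - ∑ a, p 0 a * g a) + (F (Fin.cons a ω) - g a) by ring, Real.exp_add]
              ring
          _ ≤ _ := by
              apply mul_le_mul_of_nonneg_left this
              positivity
      · simp [Fin.prod_univ_succ, ← h]
    refine (Finset.sum_le_sum fun a _ => hstep a).trans ?_
    rw [← Finset.sum_mul]
    have h0 := hone 0 g (by
      intro u v hu hv
      have : g u - g v = ∑ ω : Fin n → Ω, (∏ i, p i.succ (ω i)) *
          (F (Fin.cons u ω) - F (Fin.cons v ω)) := by
        rw [hgdef]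
        simp only [mul_sub, Finset.sum_sub_distrib]
      rw [this]
      calc _ ≤ ∑ ω : Fin n → Ω, |(∏ i, p i.succ (ω i)) *
          (F (Fin.cons u ω) - F (Fin.cons v ω))| := Finset.abs_sum_le_sum_abs _ _
        _ ≤ ∑ ω : Fin n → Ω, (∏ i, p i.succ (ω i)) * c 0 := by
          refine Finset.sum_le_sum fun ω _ => ?_
          have hnn : 0 ≤ ∏ i, p i.succ (ω i) := Finset.prod_nonneg fun i _ => hp0 _ _
          rw [abs_mul, abs_of_nonneg hnn]
          rcases hnn.lt_or_eq with h | h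
          · apply mul_le_mul_of_nonneg_left _ hnn
            have hpos : ∀ i, 0 < p i.succ (ω i) := by
              intro i
              rcases (hp0 i.succ (ω i)).lt_or_eq with h' | h'
              · exact h'
              · exact absurd (Finset.prod_eq_zero (Finset.mem_univ i) h'.symm) h.ne'
            have := hF 0 (Fin.cons u ω) v (by
              intro j
              refine Fin.cases ?_ (fun j => ?_) j
              · simpa using hu
              · simpa using hpos j) hv
            rwa [Fin.update_cons_zero] at this
          · rw [← h]; simp
        _ = c 0 := by rw [← Finset.sum_mul, hPs, one_mul])
    calc _ ≤ Real.exp κ * Real.exp (n * κ) := mul_le_mul_of_nonneg_right h0 (Real.exp_pos _).le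
      _ = _ := by rw [← Real.exp_add]; push_cast; ring_nf


theorem aux_expineq (s : ℝ) (hs : 0 ≤ s) : 1 - 0.24 * s ≤ (1 + 1.92 * s) * Real.exp (-s) := by
  have key : ∀ k e : ℝ, 0 ≤ e → e ≤ Real.exp (-k) → e * (1 + k - s) ≤ Real.exp (-s) ∨ 1 + k - s < 0 := by
    intro k e he hk
    by_cases h : 1 + k - s < 0
    · exact Or.inr h
    · left
      have h1 : Real.exp (-s) = Real.exp (-k) * Real.exp (k - s) := by
        rw [← Real.exp_add]; ring_nf
      have h2 := Real.add_one_le_exp (k - s)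
      rw [h1]
      apply mul_le_mul hk (by linarith) (by linarith) (Real.exp_pos _).le
  have hpos : 0 ≤ (1 + 1.92 * s) := by linarith
  have fin : ∀ r : ℝ, r ≤ Real.exp (-s) → 1 - 0.24 * s ≤ (1 + 1.92 * s) * r →
      1 - 0.24 * s ≤ (1 + 1.92 * s) * Real.exp (-s) := fun r h1 h2 =>
    h2.trans (mul_le_mul_of_nonneg_left h1 hpos)
  have e1 : (0.3678 : ℝ) ≤ Real.exp (-1) := by
    have := Real.exp_neg_one_gt_d9; linarith
  have en : ∀ k : ℕ, (0.3678 : ℝ) ^ k ≤ Real.exp (-(k : ℝ)) := by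
    intro k
    have : Real.exp (-(k : ℝ)) = Real.exp (-1) ^ k := by
      rw [← Real.exp_nat_mul]; ring_nf
    rw [this]
    exact pow_le_pow_left₀ (by norm_num) e1 k
  by_cases c5 : 25 / 6 ≤ s
  · have := mul_nonneg hpos (Real.exp_pos (-s)).le
    linarith
  push Not at c5
  by_cases c4 : 3.5 ≤ s
  · have h := en 4
    push_cast at h
    rcases key 4 _ (by norm_num) h with h | h
    · apply fin _ h; norm_num1; nlinarith
    · linarith
  push Not at c4
  by_cases c3 : 2.35 ≤ s
  · have h := en 3
    push_cast at h
    rcases key 3 _ (by norm_num) h with h | h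
    · apply fin _ h; norm_num1; nlinarith
    · linarith
  push Not at c3
  by_cases c2 : 1.5 ≤ s
  · have h := en 2
    push_cast at h
    rcases key 2 _ (by norm_num) h with h | h
    · apply fin _ h; norm_num1; nlinarith
    · linarith
  push Not at c2
  by_cases c1 : 0.6 ≤ s
  · rcases key 1 _ (by norm_num) e1 with h | h
    · apply fin _ h; norm_num1; nlinarith
    · linarith
  push Not at c1
  rcases key 0 1 (by norm_num) (by simp) with h | h
  · apply fin _ h; norm_num1; nlinarith
  · linarith

theorem aux_bern_small (φ : ℝ) (h0 : 0 < φ) (h1 : φ ≤ 1 / 8) (s : ℝ) :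
    (1 - φ) * Real.exp (-φ * s) + φ * Real.exp ((1 - φ) * s) ≤ Real.exp (0.12 * s ^ 2) := by
  have hD : ∀ s : ℝ, 0 < 1 - φ + φ * Real.exp s := fun s => by
    have := Real.exp_pos s
    have : 0 < φ * Real.exp s := by positivity
    linarith
  let F : ℝ → ℝ := fun s => 0.12 * s ^ 2 + φ * s - Real.log (1 - φ + φ * Real.exp s)
  have hder : ∀ s, HasDerivAt F (0.24 * s + φ - φ * Real.exp s / (1 - φ + φ * Real.exp s)) s := by
    intro s
    have a := ((hasDerivAt_pow 2 s).const_mul 0.12).add ((hasDerivAt_id s).const_mul φ)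
    have b := (((Real.hasDerivAt_exp s).const_mul φ).const_add (1 - φ)).log (hD s).ne'
    have := a.sub b
    exact this.congr_deriv (by norm_num; try ring)
  have hcont : Continuous F := continuous_iff_continuousAt.2 fun s => (hder s).continuousAt
  have hF0 : F 0 = 0 := by simp [F]
  have hFs : 0 ≤ F s := by
    rcases le_total 0 s with hs | hs
    · have hm : MonotoneOn F (Set.Ici 0) := by
        apply monotoneOn_of_deriv_nonneg (convex_Ici 0) hcont.continuousOn
          (fun s _ => (hder s).differentiableAt.differentiableWithinAt)
        intro s hs
        rw [interior_Ici, Set.mem_Ioi] at hs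
        rw [(hder s).deriv]
        have := aux_expineq s hs.le
        have e := Real.exp_pos s
        have h2 : (1 - 0.24 * s) * Real.exp s ≤ 1 + 1.92 * s := by
          have h3 := mul_le_mul_of_nonneg_right this e.le
          rwa [mul_assoc, ← Real.exp_add, neg_add_cancel, Real.exp_zero, mul_one] at h3
        rw [sub_nonneg, div_le_iff₀ (hD s)]
        have h4 : φ * Real.exp s * (1 - φ - 0.24 * s) ≤ φ * ((1 - φ) * ((1 - 0.24 * s) * Real.exp s)) := by
          have : 0 ≤ φ * Real.exp s * (0.24 * s * φ) := by positivity
          nlinarith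
        have h5 : φ * ((1 - φ) * ((1 - 0.24 * s) * Real.exp s)) ≤ φ * ((1 - φ) * (1 + 1.92 * s)) := by
          apply mul_le_mul_of_nonneg_left _ h0.le
          apply mul_le_mul_of_nonneg_left h2; linarith
        have h6 : φ * ((1 - φ) * (1 + 1.92 * s)) ≤ (φ + 0.24 * s) * (1 - φ) := by
          have : 0 ≤ (1 - φ) * s * (1 / 8 - φ) :=
            mul_nonneg (mul_nonneg (by linarith) hs.le) (by linarith)
          nlinarith
        nlinarith
      have := hm (Set.self_mem_Ici) hs hs
      rwa [hF0] at this
    · have hm : AntitoneOn F (Set.Iic 0) := by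
        apply antitoneOn_of_deriv_nonpos (convex_Iic 0) hcont.continuousOn
          (fun s _ => (hder s).differentiableAt.differentiableWithinAt)
        intro s hs
        rw [interior_Iic, Set.mem_Iio] at hs
        rw [(hder s).deriv]
        have e := Real.exp_pos s
        have e1 := Real.add_one_le_exp s
        rw [sub_nonpos, le_div_iff₀ (hD s)]
        have h3 : 0 ≤ φ * (1 - φ) * (Real.exp s - 1 - s) :=
          mul_nonneg (mul_nonneg h0.le (by linarith)) (by linarith)
        have h4 : 0 ≤ (-s) * (φ * Real.exp s) := mul_nonneg (by linarith) (by positivity)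
        have h5 : 0 ≤ (-s) * ((1 - φ) * (0.24 - φ)) :=
          mul_nonneg (by linarith) (mul_nonneg (by linarith) (by linarith))
        nlinarith
      have := hm hs (Set.self_mem_Iic) hs
      rwa [hF0] at this
  have h2 : Real.log (1 - φ + φ * Real.exp s) ≤ 0.12 * s ^ 2 + φ * s := by
    have : F s = 0.12 * s ^ 2 + φ * s - Real.log (1 - φ + φ * Real.exp s) := rfl
    linarith
  rw [Real.log_le_iff_le_exp (hD s)] at h2
  have h3 : (1 - φ) * Real.exp (-φ * s) + φ * Real.exp ((1 - φ) * s)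
      = Real.exp (-φ * s) * (1 - φ + φ * Real.exp s) := by
    rw [show (1 - φ) * s = -φ * s + s by ring, Real.exp_add]; ring
  rw [h3]
  calc _ ≤ Real.exp (-φ * s) * Real.exp (0.12 * s ^ 2 + φ * s) :=
        mul_le_mul_of_nonneg_left h2 (Real.exp_pos _).le
    _ = _ := by rw [← Real.exp_add]; ring_nf

theorem aux_N1 (φ : ℝ) (h0 : 1 / 8 ≤ φ) (h1 : φ ≤ 1 / 2) :
    (Real.log (1 - φ) - Real.log φ) ^ 2 + Real.log 2 ^ 2 ≤ Real.log φ ^ 2 := by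
  let g : ℝ → ℝ := fun x => Real.log x ^ 2 - (Real.log (1 - x) - Real.log x) ^ 2
  have d1 : ∀ x : ℝ, 0 < x → HasDerivAt Real.log (1 / x) x := fun x hx => by
    simpa using Real.hasDerivAt_log hx.ne'
  have d2 : ∀ x : ℝ, x < 1 → HasDerivAt (fun x => Real.log (1 - x)) (-(1 / (1 - x))) x := fun x hx => by
    have := ((hasDerivAt_id x).const_sub 1).log (by simp; linarith)
    simpa [neg_div] using this
  let g1 : ℝ → ℝ := fun x => 2 * (Real.log (1 - x) - Real.log x) * (1 / (1 - x)) + 2 * Real.log (1 - x) * (1 / x)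
  let g2 : ℝ → ℝ := fun x => 2 * (-(1 / (1 - x)) - 1 / x) * (1 / (1 - x)) +
    2 * (Real.log (1 - x) - Real.log x) * (1 / (1 - x) ^ 2) + (2 * (-(1 / (1 - x))) * (1 / x)
    + 2 * Real.log (1 - x) * (-(1 / x ^ 2)))
  have hc : ConcaveOn ℝ (Set.Icc (1 / 8) (1 / 2)) g := by
    apply concaveOn_of_hasDerivWithinAt2_nonpos (convex_Icc _ _) (f' := g1) (f'' := g2)
    · intro x hx
      have hx0 : 0 < x := by linarith [hx.1]
      have hx1 : x < 1 := by linarith [hx.2]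
      exact (((d1 x hx0).pow 2).sub (((d2 x hx1).sub (d1 x hx0)).pow 2)).continuousAt.continuousWithinAt
    · intro x hx
      rw [interior_Icc] at hx
      have hx0 : 0 < x := by linarith [hx.1]
      have hx1 : x < 1 := by linarith [hx.2]
      have := ((d1 x hx0).pow 2).sub (((d2 x hx1).sub (d1 x hx0)).pow 2)
      refine HasDerivAt.hasDerivWithinAt ?_
      exact this.congr_deriv (by simp only [g1, Pi.sub_apply]; norm_num; ring)
    · intro x hx
      rw [interior_Icc] at hx
      have hx0 : 0 < x := by linarith [hx.1]
      have hx1 : x < 1 := by linarith [hx.2]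
      have hx2 : 1 - x ≠ 0 := by linarith
      have i1 : HasDerivAt (fun x : ℝ => 1 / (1 - x)) (1 / (1 - x) ^ 2) x := by
        have := ((hasDerivAt_id x).const_sub 1).inv (by simpa using hx2)
        have h2 : HasDerivAt (fun x : ℝ => (1 - x)⁻¹) (1 / (1 - x) ^ 2) x := this.congr_deriv (by simp)
        simpa only [one_div] using h2
      have i2 : HasDerivAt (fun x : ℝ => 1 / x) (-(1 / x ^ 2)) x := by
        have := (hasDerivAt_id x).inv (by simpa using hx0.ne')
        have h2 : HasDerivAt (fun x : ℝ => x⁻¹) (-(1 / x ^ 2)) x := this.congr_deriv (by simp [neg_div])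
        simpa only [one_div] using h2
      refine HasDerivAt.hasDerivWithinAt ?_
      exact ((((d2 x hx1).sub (d1 x hx0)).const_mul 2).mul i1).add (((d2 x hx1).const_mul 2).mul i2)
    · intro x hx
      rw [interior_Icc] at hx
      have hx0 : 0 < x := by linarith [hx.1]
      have hx1 : 0 < 1 - x := by linarith [hx.2]
      have l1 : -Real.log (1 - x) ≤ x / (1 - x) := by
        have := Real.log_le_sub_one_of_pos (inv_pos.2 hx1)
        rw [Real.log_inv] at this
        have e : (1 - x)⁻¹ - 1 = x / (1 - x) := by field_simp; ring
        linarith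
      have l2 : Real.log (1 - x) - Real.log x ≤ 1 / x := by
        rw [← Real.log_div hx1.ne' hx0.ne']
        have := Real.log_le_sub_one_of_pos (div_pos hx1 hx0)
        have e : (1 - x) / x = 1 / x - 1 := by field_simp
        linarith
      have m1 : 2 * (Real.log (1 - x) - Real.log x) * (1 / (1 - x) ^ 2) ≤ 2 * (1 / x) * (1 / (1 - x) ^ 2) := by
        gcongr
      have m2 : 2 * (-Real.log (1 - x)) * (1 / x ^ 2) ≤ 2 * (x / (1 - x)) * (1 / x ^ 2) := by
        gcongr
      have e : g2 x = 2 * (-(1 / (1 - x)) - 1 / x) * (1 / (1 - x)) + 2 * (-(1 / (1 - x))) * (1 / x)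
        + 2 * (Real.log (1 - x) - Real.log x) * (1 / (1 - x) ^ 2) + 2 * (-Real.log (1 - x)) * (1 / x ^ 2) := by
        simp only [g2]; ring
      have e2 : 2 * (-(1 / (1 - x)) - 1 / x) * (1 / (1 - x)) + 2 * (-(1 / (1 - x))) * (1 / x)
        + 2 * (1 / x) * (1 / (1 - x) ^ 2) + 2 * (x / (1 - x)) * (1 / x ^ 2) = 0 := by
        field_simp; ring
      linarith
  have hg2 : g (1 / 2) = Real.log 2 ^ 2 := by
    simp only [g]
    rw [show (1:ℝ) - 1 / 2 = 1 / 2 by norm_num, sub_self, one_div, Real.log_inv]; ring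
  have hg8 : Real.log 2 ^ 2 ≤ g (1 / 8) := by
    simp only [g]
    have a : Real.log (1 / 8 : ℝ) = -(3 * Real.log 2) := by
      rw [one_div, Real.log_inv, show (8:ℝ) = 2 ^ 3 by norm_num, Real.log_pow]; norm_num
    have b1 : Real.log (1 - 1 / 8 : ℝ) ≤ -(1 / 8) := by
      have := Real.log_le_sub_one_of_pos (x := (1 - 1 / 8 : ℝ)) (by norm_num); linarith
    have b2 : -(1 / 7) ≤ Real.log (1 - 1 / 8 : ℝ) := by
      have := Real.log_le_sub_one_of_pos (x := (1 - 1 / 8 : ℝ)⁻¹) (by norm_num)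
      rw [Real.log_inv] at this
      have e : (1 - 1 / 8 : ℝ)⁻¹ - 1 = 1 / 7 := by norm_num
      linarith
    rw [a]
    have l1 := Real.log_two_gt_d9
    have l2 := Real.log_two_lt_d9
    set z := Real.log (1 - 1 / 8 : ℝ)
    set l := Real.log 2
    have : 0 ≤ (-(1/8) - z) * (6 * l + z - 1/8) := mul_nonneg (by linarith) (by linarith)
    nlinarith
  have := hc.min_le_of_mem_Icc (x := 1/8) (y := 1/2) (z := φ) (by norm_num) (by norm_num) ⟨h0, h1⟩
  rw [hg2, min_eq_right hg8] at this
  simp only [g] at this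
  linarith

theorem aux_N2 (φ : ℝ) (h0 : 0 < φ) (h1 : φ ≤ 1 / 8) :
    0.96 * (Real.log (1 - φ) - Real.log φ) ^ 2 + Real.log 2 ^ 2 ≤ Real.log φ ^ 2 := by
  have hz : Real.log (1 - φ) ≤ -φ := by
    have := Real.log_le_sub_one_of_pos (x := 1 - φ) (by linarith); linarith
  have l1 := Real.log_two_gt_d9
  have l2 := Real.log_two_lt_d9
  have a : Real.log (1 / 8 : ℝ) = -(3 * Real.log 2) := by
    rw [one_div, Real.log_inv, show (8:ℝ) = 2 ^ 3 by norm_num, Real.log_pow]; norm_num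
  have hX : Real.log φ ≤ -(3 * Real.log 2) := by rw [← a]; exact Real.log_le_log h0 h1
  have hmono : Real.log φ ≤ Real.log (1 - φ) := Real.log_le_log h0 (by linarith)
  set X := -Real.log φ with hXd
  have e : Real.log φ = -X := by simp [X]
  rw [e] at hX hmono ⊢
  have hle : (Real.log (1 - φ) - -X) ^ 2 ≤ (X - φ) ^ 2 := by
    apply pow_le_pow_left₀ <;> linarith
  have hX2 : 2.079 ≤ X := by linarith
  have hl : Real.log 2 ^ 2 ≤ 0.4806 := by nlinarith
  suffices 0.4806 ≤ 0.04 * X ^ 2 + 1.92 * φ * X - 0.96 * φ ^ 2 by nlinarith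
  by_cases hc : 3.4665 ≤ X
  · have : 0 ≤ φ * (X - φ) := mul_nonneg h0.le (by linarith)
    nlinarith
  · push Not at hc
    have hφ : (3.7725 - X) / 16 ≤ φ := by
      have h1 : φ = Real.exp (-X) := by rw [← e, Real.exp_log h0]
      have h2 : Real.exp (-X) = 1 / 16 * Real.exp (4 * Real.log 2 - X) := by
        rw [sub_eq_add_neg, Real.exp_add, show 4 * Real.log 2 = Real.log (2 ^ 4) by
          rw [Real.log_pow]; norm_num, Real.exp_log (by norm_num)]
        norm_num
        try ring
      have h3 := Real.add_one_le_exp (4 * Real.log 2 - X)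
      rw [h1, h2]
      linarith
    have t2 : φ ^ 2 ≤ φ / 8 := by nlinarith
    have t3 : (1.92 * X - 0.12) * ((3.7725 - X) / 16) ≤ (1.92 * X - 0.12) * φ :=
      mul_le_mul_of_nonneg_left hφ (by linarith)
    have t4 : 0 ≤ (X - 2.079) * (3.4665 - X) := mul_nonneg (by linarith) (by linarith)
    nlinarith


noncomputable def auxW {r n : ℕ} (H : Matrix (Fin r) (Fin n) (ZMod 2))
    (p : Fin n → ZMod 2 → ℝ) (s : Fin r → ZMod 2) : ℝ :=
  ∑ z : Fin n → ZMod 2, if H.mulVec z = s then ∏ j, p j (z j) else 0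

theorem auxW_nonneg {r n : ℕ} (H : Matrix (Fin r) (Fin n) (ZMod 2))
    (p : Fin n → ZMod 2 → ℝ) (hp : ∀ j z, 0 ≤ p j z) (s : Fin r → ZMod 2) :
    0 ≤ auxW H p s := by
  refine Finset.sum_nonneg fun z _ => ?_
  split_ifs
  · exact Finset.prod_nonneg fun j _ => hp _ _
  · exact le_rfl

theorem auxW_pos {r n : ℕ} (H : Matrix (Fin r) (Fin n) (ZMod 2))
    (p : Fin n → ZMod 2 → ℝ) (hp : ∀ j z, 0 ≤ p j z) (x : Fin n → ZMod 2)
    (hx : ∀ j, 0 < p j (x j)) :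
    0 < auxW H p (H.mulVec x) := by
  refine Finset.sum_pos' (fun z _ => ?_) ⟨x, Finset.mem_univ _, ?_⟩
  · split_ifs
    · exact Finset.prod_nonneg fun j _ => hp _ _
    · exact le_rfl
  · simp only [if_true]
    exact Finset.prod_pos fun j _ => hx j

theorem auxW_ratio {r n : ℕ} (H : Matrix (Fin r) (Fin n) (ZMod 2))
    (p p' : Fin n → ZMod 2 → ℝ) (hp' : ∀ j z, 0 ≤ p' j z)
    (i : Fin n) (δ : ZMod 2) (R : ℝ)
    (hag : ∀ j, j ≠ i → p j = p' j) (h : ∀ z, p i z ≤ R * p' i (z + δ)) (s : Fin r → ZMod 2) :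
    auxW H p s ≤ R * auxW H p' (s + H.mulVec (Pi.single i δ)) := by
  unfold auxW
  rw [← Equiv.sum_comp (Equiv.addRight (Pi.single i δ : Fin n → ZMod 2))
    (fun z => if H.mulVec z = s + H.mulVec (Pi.single i δ) then ∏ j, p' j (z j) else 0),
    Finset.mul_sum]
  refine Finset.sum_le_sum fun z _ => ?_
  simp only [Equiv.coe_addRight, Matrix.mulVec_add, add_left_inj]
  split_ifs
  · rw [← Finset.mul_prod_erase _ _ (Finset.mem_univ i), ← Finset.mul_prod_erase _ _ (Finset.mem_univ i),
      ← mul_assoc]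
    have e : ∏ j ∈ Finset.univ.erase i, p' j ((z + Pi.single i δ : Fin n → ZMod 2) j) =
        ∏ j ∈ Finset.univ.erase i, p j (z j) := by
      refine Finset.prod_congr rfl fun j hj => ?_
      have hj := Finset.ne_of_mem_erase hj
      rw [hag j hj]
      simp [hj]
    rw [e]
    refine mul_le_mul_of_nonneg_right ?_ ?_
    · simpa using h (z i)
    · refine Finset.prod_nonneg fun j hj => ?_
      rw [hag j (Finset.ne_of_mem_erase hj)]
      exact hp' _ _
  · simp

theorem auxW_logdiff {r n : ℕ} (H : Matrix (Fin r) (Fin n) (ZMod 2))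
    (p p' : Fin n → ZMod 2 → ℝ) (hp : ∀ j z, 0 ≤ p j z) (hp' : ∀ j z, 0 ≤ p' j z)
    (i : Fin n) (R : ℝ) (hR : 0 < R) (hag : ∀ j, j ≠ i → p j = p' j)
    (x : Fin n → ZMod 2) (v : ZMod 2)
    (hx : ∀ j, 0 < p j (x j)) (hx' : ∀ j, 0 < p' j (Function.update x i v j))
    (h : ∀ z, p i z ≤ R * p' i (z + (v - x i))) (h' : ∀ z, p' i z ≤ R * p i (z + (v - x i))) :
    |Real.logb 2 (auxW H p (H.mulVec x)) -
      Real.logb 2 (auxW H p' (H.mulVec (Function.update x i v)))| ≤ Real.logb 2 R := by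
  have e1 : Function.update x i v = x + Pi.single i (v - x i) := by
    funext j
    by_cases hj : j = i
    · subst hj; simp
    · simp [hj]
  have e2 : x = Function.update x i v + Pi.single i (v - x i) := by
    rw [e1, add_assoc, ← Pi.single_add]
    have : v - x i + (v - x i) = 0 := by
      generalize v - x i = d; revert d; decide
    rw [this]; simp
  have r1 := auxW_ratio H p p' hp' i _ R hag h (H.mulVec x)
  rw [← Matrix.mulVec_add, ← e1] at r1
  have r2 := auxW_ratio H p' p hp i _ R (fun j hj => (hag j hj).symm) h'
    (H.mulVec (Function.update x i v))
  rw [← Matrix.mulVec_add, ← e2] at r2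
  have p1 := auxW_pos H p hp x hx
  have p2 := auxW_pos H p' hp' _ hx'
  have l1 := Real.logb_le_logb_of_le (b := 2) (by norm_num) p1 r1
  have l2 := Real.logb_le_logb_of_le (b := 2) (by norm_num) p2 r2
  rw [Real.logb_mul hR.ne' p2.ne'] at l1
  rw [Real.logb_mul hR.ne' p1.ne'] at l2
  rw [abs_le]
  constructor <;> linarith

theorem auxW_sum {r n : ℕ} (H : Matrix (Fin r) (Fin n) (ZMod 2))
    (p : Fin n → ZMod 2 → ℝ) (f : (Fin r → ZMod 2) → ℝ) :
    ∑ s, auxW H p s * f s = ∑ x : Fin n → ZMod 2, (∏ j, p j (x j)) * f (H.mulVec x) := by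
  unfold auxW
  simp only [Finset.sum_mul]
  rw [Finset.sum_comm]
  refine Finset.sum_congr rfl fun x _ => ?_
  simp [ite_mul]

theorem aux_eta_sub (x y : ℝ) (hx : 0 ≤ x) (hy : 0 ≤ y) :
    Real.negMulLog (x + y) ≤ Real.negMulLog x + Real.negMulLog y := by
  have key : ∀ x y : ℝ, 0 ≤ x → 0 ≤ y → x * Real.log x ≤ x * Real.log (x + y) := by
    intro x y hx hy
    rcases hx.lt_or_eq with h | h
    · exact mul_le_mul_of_nonneg_left (Real.log_le_log h (by linarith)) hx
    · rw [← h]; simp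
  have a := key x y hx hy
  have b := key y x hy hx
  rw [add_comm y x] at b
  simp only [Real.negMulLog]
  linarith

theorem aux_sum_zmod2 (f : ZMod 2 → ℝ) : ∑ a, f a = f 0 + f 1 := Fin.sum_univ_two f

theorem aux_entropy {r n : ℕ} (H : Matrix (Fin r) (Fin n) (ZMod 2))
    (p : Fin n → ZMod 2 → ℝ) (hp : ∀ j z, 0 ≤ p j z) (hp1 : ∀ j, ∑ z, p j z = 1) (i : Fin n) :
    let A := ∑ s, Real.negMulLog (auxW H (Function.update p i (Pi.single 0 1)) s)
    A ≤ ∑ s, Real.negMulLog (auxW H p s) ∧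
      ∑ s, Real.negMulLog (auxW H p s) ≤ A + Real.log 2 := by
  intro A
  set m0 := auxW H (Function.update p i (Pi.single 0 1)) with hm0
  set m1 := auxW H (Function.update p i (Pi.single 1 1)) with hm1
  have hnn : ∀ c : ZMod 2, ∀ j z, 0 ≤ (Function.update p i (Pi.single c 1) : Fin n → ZMod 2 → ℝ) j z := by
    intro c j z
    by_cases hj : j = i
    · subst hj
      simp only [Function.update_self, Pi.single_apply]
      split_ifs <;> norm_num
    · simp [hj, hp]
  have n0 : ∀ s, 0 ≤ m0 s := auxW_nonneg H _ (hnn 0)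
  have n1 : ∀ s, 0 ≤ m1 s := auxW_nonneg H _ (hnn 1)
  have hW : ∀ s, auxW H p s = p i 0 * m0 s + p i 1 * m1 s := by
    intro s
    simp only [hm0, hm1, auxW, Finset.mul_sum, ← Finset.sum_add_distrib]
    refine Finset.sum_congr rfl fun z _ => ?_
    split_ifs
    · simp only [← Finset.mul_prod_erase _ _ (Finset.mem_univ i), Function.update_self]
      have e : ∀ c : ZMod 2, ∏ j ∈ Finset.univ.erase i, (Function.update p i (Pi.single c 1) : Fin n → ZMod 2 → ℝ) j (z j)
          = ∏ j ∈ Finset.univ.erase i, p j (z j) := by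
        intro c
        refine Finset.prod_congr rfl fun j hj => ?_
        simp [Finset.ne_of_mem_erase hj]
      rw [e, e]
      have : z i = 0 ∨ z i = 1 := by generalize z i = d; revert d; decide
      rcases this with h | h <;> rw [h] <;> simp
    · simp
  have hshift : ∀ s, m1 s = m0 (s + H.mulVec (Pi.single i 1)) := by
    intro s
    apply le_antisymm
    · have := auxW_ratio H (Function.update p i (Pi.single 1 1)) (Function.update p i (Pi.single 0 1))
        (hnn 0) i 1 1 (fun j hj => by simp [hj]) (by
          intro z
          have : z = 0 ∨ z = 1 := by revert z; decide
          rcases this with h | h <;> rw [h] <;> simp [Pi.single_apply]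
          all_goals (try split_ifs)
          all_goals norm_num
          all_goals (rename_i h1; revert h1; decide)) s
      simpa using this
    · have := auxW_ratio H (Function.update p i (Pi.single 0 1)) (Function.update p i (Pi.single 1 1))
        (hnn 1) i 1 1 (fun j hj => by simp [hj]) (by
          intro z
          have : z = 0 ∨ z = 1 := by revert z; decide
          rcases this with h | h <;> rw [h] <;> simp [Pi.single_apply]
          all_goals (try split_ifs)
          all_goals norm_num
          all_goals (rename_i h1; revert h1; decide)) (s + H.mulVec (Pi.single i 1))
      rw [add_assoc, ← Matrix.mulVec_add, ← Pi.single_add, show (1 : ZMod 2) + 1 = 0 by decide] at this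
      simpa using this
  have hA1 : ∑ s, Real.negMulLog (m1 s) = A := by
    simp only [hshift]
    exact Equiv.sum_comp (Equiv.addRight (H.mulVec (Pi.single i 1))) (fun s => Real.negMulLog (m0 s))
  have hM1 : ∑ s, m1 s = ∑ s, m0 s := by
    simp only [hshift]
    exact Equiv.sum_comp (Equiv.addRight (H.mulVec (Pi.single i 1))) m0
  have hM0 : ∑ s, m0 s = 1 := by
    have := auxW_sum H (Function.update p i (Pi.single 0 1)) (fun _ => 1)
    simp only [mul_one] at this
    rw [hm0, this, ← Fintype.prod_sum]
    refine Finset.prod_eq_one fun j _ => ?_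
    by_cases hj : j = i
    · subst hj; simp
    · simp [hj, hp1]
  have hs : p i 0 + p i 1 = 1 := by rw [← aux_sum_zmod2]; exact hp1 i
  have hA0 : ∑ s, Real.negMulLog (m0 s) = A := rfl
  constructor
  · calc A = p i 0 * A + p i 1 * A := by rw [← add_mul, hs, one_mul]
      _ = ∑ s, (p i 0 * Real.negMulLog (m0 s) + p i 1 * Real.negMulLog (m1 s)) := by
        rw [Finset.sum_add_distrib, ← Finset.mul_sum, ← Finset.mul_sum, hA1]
      _ ≤ _ := by
        refine Finset.sum_le_sum fun s _ => ?_
        rw [hW]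
        have := Real.concaveOn_negMulLog.2 (x := m0 s) (y := m1 s) (n0 s) (n1 s) (hp i 0) (hp i 1) hs
        simpa using this
  · have c1 : ∑ s, Real.negMulLog (auxW H p s)
        ≤ ∑ s, (m0 s * Real.negMulLog (p i 0) + p i 0 * Real.negMulLog (m0 s)
          + (m1 s * Real.negMulLog (p i 1) + p i 1 * Real.negMulLog (m1 s))) := by
      refine Finset.sum_le_sum fun s _ => ?_
      rw [hW, ← Real.negMulLog_mul, ← Real.negMulLog_mul]
      exact aux_eta_sub _ _ (mul_nonneg (hp _ _) (n0 s)) (mul_nonneg (hp _ _) (n1 s))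
    have c2 : ∑ s, (m0 s * Real.negMulLog (p i 0) + p i 0 * Real.negMulLog (m0 s)
          + (m1 s * Real.negMulLog (p i 1) + p i 1 * Real.negMulLog (m1 s)))
        = A + (Real.negMulLog (p i 0) + Real.negMulLog (p i 1)) := by
      simp only [Finset.sum_add_distrib, ← Finset.mul_sum, ← Finset.sum_mul, hA1, hM1, hM0, hA0]
      linear_combination A * hs
    have := Real.binEntropy_le_log_two (p := p i 0)
    rw [Real.binEntropy_eq_negMulLog_add_negMulLog_one_sub, show 1 - p i 0 = p i 1 by linarith] at this
    linarith

theorem aux_entropy_diff {r n : ℕ} (H : Matrix (Fin r) (Fin n) (ZMod 2))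
    (p p' : Fin n → ZMod 2 → ℝ) (hp : ∀ j z, 0 ≤ p j z) (hp1 : ∀ j, ∑ z, p j z = 1)
    (hp' : ∀ j z, 0 ≤ p' j z) (hp1' : ∀ j, ∑ z, p' j z = 1) (i : Fin n)
    (hag : ∀ j, j ≠ i → p j = p' j) :
    |(∑ x : Fin n → ZMod 2, (∏ j, p j (x j)) * Real.logb 2 (auxW H p (H.mulVec x))) -
     (∑ x : Fin n → ZMod 2, (∏ j, p' j (x j)) * Real.logb 2 (auxW H p' (H.mulVec x)))| ≤ 1 := by
  have conv : ∀ p : Fin n → ZMod 2 → ℝ,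
      (∑ x : Fin n → ZMod 2, (∏ j, p j (x j)) * Real.logb 2 (auxW H p (H.mulVec x)))
      = -(∑ s, Real.negMulLog (auxW H p s)) / Real.log 2 := by
    intro p
    rw [← auxW_sum H p (fun s => Real.logb 2 (auxW H p s)), ← Finset.sum_neg_distrib, Finset.sum_div]
    refine Finset.sum_congr rfl fun s _ => ?_
    simp only [Real.negMulLog, Real.logb]; ring
  have hl := Real.log_pos (x := 2) (by norm_num)
  rw [conv, conv, ← sub_div, abs_div, abs_of_pos hl, div_le_one hl]
  have a := aux_entropy H p hp hp1 i
  have b := aux_entropy H p' hp' hp1' i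
  have e : Function.update p i (Pi.single 0 1) = Function.update p' i (Pi.single 0 1) := by
    funext j
    by_cases hj : j = i
    · subst hj; simp
    · simp [hj, hag j hj]
  simp only [e] at a b
  rw [abs_le]
  constructor <;> linarith [a.1, a.2, b.1, b.2]


theorem aux_mcd_h {Ω : Type*} [Fintype Ω] (n : ℕ) (p : Ω → ℝ) (hp0 : ∀ u, 0 ≤ p u)
    (hp1 : ∑ u, p u = 1) (c : ℝ) (F : (Fin n → Ω) → ℝ)
    (hF : ∀ i ω v, (∀ j, 0 < p (ω j)) → 0 < p v → |F ω - F (Function.update ω i v)| ≤ c)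
    (l : ℝ) :
    ∑ ω : Fin n → Ω, (∏ i, p (ω i)) *
      Real.exp (l * (F ω - ∑ ω' : Fin n → Ω, (∏ i, p (ω' i)) * F ω'))
      ≤ Real.exp (n * (l ^ 2 * c ^ 2 / 8)) := by
  have := aux_mcd (l ^ 2 * c ^ 2 / 8) n (fun _ => p) (fun _ => hp0) (fun _ => hp1) (fun _ => |l| * c)
    (by
      intro i g hg
      have := aux_hoeffding p hp0 hp1 _ g hg
      rwa [mul_pow, sq_abs] at this) (fun ω => l * F ω) (by
      intro i ω v h1 h2
      rw [← mul_sub, abs_mul]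
      exact mul_le_mul_of_nonneg_left (hF i ω v h1 h2) (abs_nonneg _))
  refine le_trans (le_of_eq ?_) this
  refine Finset.sum_congr rfl fun ω _ => ?_
  congr 2
  rw [mul_sub, Finset.mul_sum]
  congr 1
  refine Finset.sum_congr rfl fun ω _ => ?_
  ring

theorem aux_bern_core (φ : ℝ) (h0 : 0 < φ) (h1 : φ ≤ 1 / 2) (d K l : ℝ)
    (hd : |d| ≤ |l| * ((Real.log (1 - φ) - Real.log φ) / Real.log 2))
    (hK : -(Real.log φ / Real.log 2) ≤ K) :
    (1 - φ) * Real.exp (-φ * d) + φ * Real.exp ((1 - φ) * d) ≤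
      Real.exp (l ^ 2 * (K ^ 2 - 1) / 8) := by
  have hl2 := Real.log_pos (x := 2) (by norm_num)
  have hneg : Real.log φ ≤ 0 := Real.log_nonpos h0.le (by linarith)
  have hKsq : (Real.log φ / Real.log 2) ^ 2 ≤ K ^ 2 := by
    rw [← neg_sq (Real.log φ / Real.log 2)]
    apply pow_le_pow_left₀ _ hK
    rw [← neg_div]
    exact div_nonneg (by linarith) hl2.le
  set ℓ := (Real.log (1 - φ) - Real.log φ) / Real.log 2 with hℓ
  have hdsq : d ^ 2 ≤ l ^ 2 * ℓ ^ 2 := by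
    have := pow_le_pow_left₀ (abs_nonneg d) hd 2
    rwa [mul_pow, sq_abs, sq_abs] at this
  have hs : 0 ≤ l ^ 2 := sq_nonneg l
  by_cases hc : φ ≤ 1 / 8
  · refine (aux_bern_small φ h0 hc d).trans (Real.exp_le_exp.2 ?_)
    have h2 := aux_N2 φ h0 hc
    have h3 : 0.96 * ℓ ^ 2 + 1 ≤ (Real.log φ / Real.log 2) ^ 2 := by
      rw [hℓ, div_pow, div_pow, le_div_iff₀ (by positivity)]
      have : (Real.log (1 - φ) - Real.log φ) ^ 2 / Real.log 2 ^ 2 * Real.log 2 ^ 2 =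
        (Real.log (1 - φ) - Real.log φ) ^ 2 := by field_simp
      linear_combination h2 + 0.96 * this
    have h4 : l ^ 2 * (0.96 * ℓ ^ 2) ≤ l ^ 2 * (K ^ 2 - 1) :=
      mul_le_mul_of_nonneg_left (by linarith) hs
    linarith
  · push Not at hc
    have h2 := aux_N1 φ hc.le h1
    have h3 : ℓ ^ 2 + 1 ≤ (Real.log φ / Real.log 2) ^ 2 := by
      rw [hℓ, div_pow, div_pow, le_div_iff₀ (by positivity)]
      have : (Real.log (1 - φ) - Real.log φ) ^ 2 / Real.log 2 ^ 2 * Real.log 2 ^ 2 =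
        (Real.log (1 - φ) - Real.log φ) ^ 2 := by field_simp
      linear_combination h2 + this
    have h4 : l ^ 2 * (ℓ ^ 2) ≤ l ^ 2 * (K ^ 2 - 1) :=
      mul_le_mul_of_nonneg_left (by linarith) hs
    have := aux_hoeffding (Ω := Bool) (fun u => if u then φ else 1 - φ)
      (by intro u; cases u <;> simp <;> linarith) (by simp) |d| (fun u => if u then d else 0)
      (by intro u v _ _; cases u <;> cases v <;> simp)
    rw [sq_abs] at this
    refine le_trans (le_of_eq ?_) (this.trans (Real.exp_le_exp.2 (by linarith)))
    simp
    rw [show (1 - φ) * d = d - φ * d by ring]; ring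

theorem aux_bern (p : ZMod 2 → ℝ) (hp0 : ∀ a, 0 ≤ p a) (hp1 : p 0 + p 1 = 1) (K l : ℝ)
    (hK1 : 1 ≤ K) (hK : ∀ a, 0 < p a → -Real.logb 2 (p a) ≤ K) (g : ZMod 2 → ℝ)
    (hg : ∀ u v, 0 < p u → 0 < p v → |g u - g v| ≤
      |l| * |Real.logb 2 (p 0) - Real.logb 2 (p 1)|) :
    ∑ u, p u * Real.exp (g u - ∑ v, p v * g v) ≤ Real.exp (l ^ 2 * (K ^ 2 - 1) / 8) := by
  have hS : ∀ f : ZMod 2 → ℝ, ∑ a, f a = f 0 + f 1 := fun f => Fin.sum_univ_two f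
  simp only [hS]
  have hl2 := Real.log_pos (x := 2) (by norm_num)
  have hE : 0 ≤ l ^ 2 * (K ^ 2 - 1) / 8 := by
    have : 0 ≤ K ^ 2 - 1 := by nlinarith
    positivity
  rcases (hp0 0).lt_or_eq with a0 | a0
  swap
  · rw [← a0, show p 1 = 1 by linarith]; simpa using hE
  rcases (hp0 1).lt_or_eq with a1 | a1
  swap
  · rw [← a1, show p 0 = 1 by linarith]; simpa using hE
  simp only [Real.logb] at hg hK
  rw [← sub_div] at hg
  rcases le_total (p 0) (p 1) with h | h
  · have e : p 1 = 1 - p 0 := by linarith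
    have := aux_bern_core (p 0) a0 (by linarith) (g 0 - g 1) K l (by
      refine (hg 0 1 a0 a1).trans (le_of_eq ?_)
      rw [abs_div, abs_sub_comm, abs_of_pos hl2, e, abs_of_nonneg (a := Real.log (1 - p 0) - Real.log (p 0))]
      rw [sub_nonneg]; exact Real.log_le_log a0 (by linarith)) (hK 0 a0)
    refine le_trans (le_of_eq ?_) this
    rw [e, show g 0 - (p 0 * g 0 + (1 - p 0) * g 1) = (1 - p 0) * (g 0 - g 1) by ring,
      show g 1 - (p 0 * g 0 + (1 - p 0) * g 1) = - p 0 * (g 0 - g 1) by ring]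
    ring
  · have e : p 0 = 1 - p 1 := by linarith
    have := aux_bern_core (p 1) a1 (by linarith) (g 1 - g 0) K l (by
      refine (hg 1 0 a1 a0).trans (le_of_eq ?_)
      rw [abs_div, abs_of_pos hl2, e, abs_of_nonneg (a := Real.log (1 - p 1) - Real.log (p 1))]
      rw [sub_nonneg]; exact Real.log_le_log a1 (by linarith)) (hK 1 a1)
    refine le_trans (le_of_eq ?_) this
    rw [e, show g 0 - ((1 - p 1) * g 0 + p 1 * g 1) = - p 1 * (g 1 - g 0) by ring,
      show g 1 - ((1 - p 1) * g 0 + p 1 * g 1) = (1 - p 1) * (g 1 - g 0) by ring]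

open scoped Classical in
theorem aux_final {ι : Type*} [Fintype ι] (J U V : ι → ℝ) (hJ0 : ∀ i, 0 ≤ J i)
    (hJ1 : ∑ i, J i = 1) (n : ℝ) (hn : 0 ≤ n) (K b : ℝ) (hK : 0 ≤ K) (hb : 0 ≤ b)
    (hU : ∀ l : ℝ, ∑ i, J i * Real.exp (l * (U i - ∑ k, J k * U k)) ≤
      Real.exp (n * (l ^ 2 * K ^ 2 / 8)))
    (hV : ∀ l : ℝ, ∑ i, J i * Real.exp (l * (V i - ∑ k, J k * V k)) ≤
      Real.exp (n * (l ^ 2 * b ^ 2 / 8))) (ε : ℝ) (hε : 0 < ε) :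
    ∑ i, (if (∑ k, J k * U k) - (∑ k, J k * V k) + n * ε < U i - V i then J i else 0)
      ≤ Real.exp (-(2 * n * ε ^ 2) / (K + b) ^ 2) := by
  set EU := ∑ k, J k * U k
  set EV := ∑ k, J k * V k
  by_cases hL : K + b = 0
  · rw [hL]
    simp only [ne_eq, OfNat.ofNat_ne_zero, not_false_eq_true, zero_pow, div_zero, Real.exp_zero]
    rw [← hJ1]
    refine Finset.sum_le_sum fun i _ => ?_
    split_ifs
    · exact le_rfl
    · exact hJ0 i
  have key : ∀ τ : ℝ, 0 < τ →
      ∑ i, (if EU - EV + n * ε < U i - V i then J i else 0)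
      ≤ Real.exp (-(2 * n * ε ^ 2) / (K + b + 2 * τ) ^ 2) := by
    intro τ hτ
    set L := K + b + 2 * τ with hLd
    have hL0 : 0 < L := by linarith
    set l := 4 * ε / L ^ 2 with hl
    have hl0 : 0 < l := by positivity
    set c := n * (l ^ 2 * L ^ 2 / 8) with hc
    set θ := (K + τ) / L with hθ
    set θ' := (b + τ) / L with hθ'
    have hθ0 : 0 < θ := by positivity
    have hθ0' : 0 < θ' := by positivity
    have hθs : θ + θ' = 1 := by
      rw [hθ, hθ', ← add_div, div_eq_one_iff_eq hL0.ne', hLd]; ring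
    have sub : ∀ (k T : ℝ) (m : ℝ), 0 ≤ k → k ≤ T * L → 0 < T → m ^ 2 = l ^ 2 →
        n * ((m / T) ^ 2 * k ^ 2 / 8) - c ≤ 0 := by
      intro k T m hk hkT hT hm
      have : (m / T) ^ 2 * k ^ 2 ≤ l ^ 2 * L ^ 2 := by
        rw [div_pow, hm, div_mul_eq_mul_div, div_le_iff₀ (by positivity)]
        have := pow_le_pow_left₀ hk hkT 2
        nlinarith [mul_le_mul_of_nonneg_left this (sq_nonneg l)]
      rw [hc, ← mul_sub]
      apply mul_nonpos_of_nonneg_of_nonpos hn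
      linarith
    have hUb : ∑ i, J i * Real.exp (l / θ * (U i - EU) - c) ≤ 1 := by
      have h1 := hU (l / θ)
      have : ∑ i, J i * Real.exp (l / θ * (U i - EU) - c) =
          (∑ i, J i * Real.exp (l / θ * (U i - EU))) * Real.exp (-c) := by
        rw [Finset.sum_mul]
        refine Finset.sum_congr rfl fun i _ => ?_
        rw [sub_eq_add_neg _ c, Real.exp_add]; ring
      rw [this]
      refine (mul_le_mul_of_nonneg_right h1 (Real.exp_pos _).le).trans ?_
      rw [← Real.exp_add, ← Real.exp_zero]
      apply Real.exp_le_exp.2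
      rw [← sub_eq_add_neg]
      refine sub K θ l hK ?_ hθ0 rfl
      rw [hθ, div_mul_cancel₀ _ hL0.ne']; linarith
    have hVb : ∑ i, J i * Real.exp (-l / θ' * (V i - EV) - c) ≤ 1 := by
      have h1 := hV (-l / θ')
      have : ∑ i, J i * Real.exp (-l / θ' * (V i - EV) - c) =
          (∑ i, J i * Real.exp (-l / θ' * (V i - EV))) * Real.exp (-c) := by
        rw [Finset.sum_mul]
        refine Finset.sum_congr rfl fun i _ => ?_
        rw [sub_eq_add_neg _ c, Real.exp_add]; ring
      rw [this]
      refine (mul_le_mul_of_nonneg_right h1 (Real.exp_pos _).le).trans ?_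
      rw [← Real.exp_add, ← Real.exp_zero]
      apply Real.exp_le_exp.2
      rw [← sub_eq_add_neg]
      refine sub b θ' (-l) hb ?_ hθ0' (by ring)
      rw [hθ', div_mul_cancel₀ _ hL0.ne']; linarith
    have hcomb : ∑ i, J i * Real.exp (l * (U i - EU - (V i - EV)) - c) ≤ 1 := by
      calc ∑ i, J i * Real.exp (l * (U i - EU - (V i - EV)) - c)
          ≤ ∑ i, (θ * (J i * Real.exp (l / θ * (U i - EU) - c)) +
            θ' * (J i * Real.exp (-l / θ' * (V i - EV) - c))) := by
            refine Finset.sum_le_sum fun i _ => ?_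
            have := convexOn_exp.2 (Set.mem_univ (l / θ * (U i - EU) - c))
              (Set.mem_univ (-l / θ' * (V i - EV) - c)) hθ0.le hθ0'.le hθs
            simp only [smul_eq_mul] at this
            have e : θ * (l / θ * (U i - EU) - c) + θ' * (-l / θ' * (V i - EV) - c) =
                l * (U i - EU - (V i - EV)) - c := by
              have : θ * (l / θ * (U i - EU) - c) = l * (U i - EU) - θ * c := by field_simp
              rw [this]
              have : θ' * (-l / θ' * (V i - EV) - c) = -l * (V i - EV) - θ' * c := by field_simp
              rw [this]
              linear_combination (-c) * hθs
            rw [e] at this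
            nlinarith [mul_le_mul_of_nonneg_left this (hJ0 i)]
        _ = θ * ∑ i, J i * Real.exp (l / θ * (U i - EU) - c) +
            θ' * ∑ i, J i * Real.exp (-l / θ' * (V i - EV) - c) := by
            rw [Finset.sum_add_distrib, ← Finset.mul_sum, ← Finset.mul_sum]
        _ ≤ θ * 1 + θ' * 1 := by gcongr
        _ = 1 := by linarith
    calc ∑ i, (if EU - EV + n * ε < U i - V i then J i else 0)
        ≤ ∑ i, J i * Real.exp (l * (U i - EU - (V i - EV)) - c) * Real.exp (c - l * (n * ε)) := by
          refine Finset.sum_le_sum fun i _ => ?_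
          rw [mul_assoc, ← Real.exp_add]
          split_ifs with h
          · have : 1 ≤ Real.exp (l * (U i - EU - (V i - EV)) - c + (c - l * (n * ε))) := by
              apply Real.one_le_exp
              have : 0 ≤ l * (U i - V i - (EU - EV + n * ε)) := mul_nonneg hl0.le (by linarith)
              linarith
            exact le_mul_of_one_le_right (hJ0 i) this
          · exact mul_nonneg (hJ0 i) (Real.exp_pos _).le
      _ ≤ 1 * Real.exp (c - l * (n * ε)) := by
          rw [← Finset.sum_mul]
          exact mul_le_mul_of_nonneg_right hcomb (Real.exp_pos _).le
      _ = _ := by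
          rw [one_mul]
          congr 1
          rw [hc, hl]
          field_simp
          ring
  have hcont : ContinuousAt (fun τ : ℝ => Real.exp (-(2 * n * ε ^ 2) / (K + b + 2 * τ) ^ 2)) 0 := by
    refine Real.continuous_exp.continuousAt.comp ?_
    refine ContinuousAt.div (by fun_prop) (by fun_prop) ?_
    simpa using hL
  have ht : Filter.Tendsto (fun τ : ℝ => Real.exp (-(2 * n * ε ^ 2) / (K + b + 2 * τ) ^ 2))
      (nhdsWithin 0 (Set.Ioi 0)) (nhds (Real.exp (-(2 * n * ε ^ 2) / (K + b) ^ 2))) := by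
    have := hcont.tendsto
    simp only [mul_zero, add_zero] at this
    exact this.mono_left nhdsWithin_le_nhds
  refine ge_of_tendsto ht ?_
  filter_upwards [self_mem_nhdsWithin] with τ hτ
  exact key τ hτ


noncomputable def auxT {Y : Type*} (q : ZMod 2 → ℝ) (w : ZMod 2 → Y → ℝ) (b : Y) : ℝ :=
  ∑ a, q a * w a b

noncomputable def auxPost {Y : Type*} (q : ZMod 2 → ℝ) (w : ZMod 2 → Y → ℝ) (b : Y)
    (a : ZMod 2) : ℝ := q a * w a b / auxT q w b

section
variable {Y : Type*} (q : ZMod 2 → ℝ) (w : ZMod 2 → Y → ℝ)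
  (hq0 : ∀ a, 0 ≤ q a) (hw0 : ∀ a b, 0 ≤ w a b)

theorem auxT_nonneg (hq0 : ∀ a, 0 ≤ q a) (hw0 : ∀ a b, 0 ≤ w a b) (b : Y) : 0 ≤ auxT q w b :=
  Finset.sum_nonneg fun a _ => mul_nonneg (hq0 a) (hw0 a b)

theorem auxT_ge (hq0 : ∀ a, 0 ≤ q a) (hw0 : ∀ a b, 0 ≤ w a b) (a : ZMod 2) (b : Y) :
    q a * w a b ≤ auxT q w b :=
  Finset.single_le_sum (f := fun a => q a * w a b)
    (fun a _ => mul_nonneg (hq0 a) (hw0 a b)) (Finset.mem_univ a)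

theorem auxPost_nonneg (hq0 : ∀ a, 0 ≤ q a) (hw0 : ∀ a b, 0 ≤ w a b) (b : Y) (a : ZMod 2) :
    0 ≤ auxPost q w b a :=
  div_nonneg (mul_nonneg (hq0 a) (hw0 a b)) (auxT_nonneg q w hq0 hw0 b)

theorem auxPost_sum (b : Y) (hb : 0 < auxT q w b) : ∑ a, auxPost q w b a = 1 := by
  unfold auxPost
  rw [← Finset.sum_div]
  exact div_self hb.ne'

theorem auxPost_mul (hq0 : ∀ a, 0 ≤ q a) (hw0 : ∀ a b, 0 ≤ w a b) (b : Y) (a : ZMod 2) :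
    q a * w a b = auxT q w b * auxPost q w b a := by
  rcases (auxT_nonneg q w hq0 hw0 b).lt_or_eq with h | h
  · unfold auxPost; field_simp
  · have h1 := auxT_ge q w hq0 hw0 a b
    have h2 := mul_nonneg (hq0 a) (hw0 a b)
    rw [← h]; linarith

theorem auxPost_pos (hq0 : ∀ a, 0 ≤ q a) (hw0 : ∀ a b, 0 ≤ w a b) (b : Y) (a : ZMod 2)
    (h : 0 < q a * w a b) : 0 < auxPost q w b a :=
  div_pos h (h.trans_le (auxT_ge q w hq0 hw0 a b))

theorem auxQW_sum [Fintype Y] (hq1 : ∑ a, q a = 1) (hw1 : ∀ a, ∑ b, w a b = 1) :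
    ∑ u : ZMod 2 × Y, q u.1 * w u.1 u.2 = 1 := by
  rw [Fintype.sum_prod_type]
  simp only [← Finset.mul_sum, hw1, mul_one, hq1]

theorem auxT_sum [Fintype Y] (hq1 : ∑ a, q a = 1) (hw1 : ∀ a, ∑ b, w a b = 1) :
    ∑ b : Y, auxT q w b = 1 := by
  unfold auxT
  rw [Finset.sum_comm]
  simp only [← Finset.mul_sum, hw1, mul_one, hq1]

end

theorem aux_sum_pair {Y : Type*} [Fintype Y] {n : ℕ} (f : (Fin n → ZMod 2 × Y) → ℝ) :
    ∑ ω, f ω = ∑ x : Fin n → ZMod 2, ∑ y : Fin n → Y, f (fun j => (x j, y j)) := by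
  rw [← (Equiv.arrowProdEquivProdArrow (Fin n) (fun _ => ZMod 2) (fun _ => Y)).symm.sum_comp,
    Fintype.sum_prod_type]
  rfl

theorem aux_MV {Y : Type*} [Fintype Y] (r n : ℕ)
    (H : Matrix (Fin r) (Fin n) (ZMod 2))
    (q : ZMod 2 → ℝ) (hq0 : ∀ a, 0 ≤ q a) (hq1 : ∑ a, q a = 1)
    (w : ZMod 2 → Y → ℝ) (hw0 : ∀ a b, 0 ≤ w a b) (hw1 : ∀ a, ∑ b, w a b = 1)
    (R : ℝ) (hR1 : 1 ≤ R) (hR : ∀ a a', 0 < q a → 0 < q a' → q a ≤ R * q a') (l : ℝ) :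
    ∑ ω : Fin n → ZMod 2 × Y, (∏ i, q (ω i).1 * w (ω i).1 (ω i).2) *
      Real.exp (l * (Real.logb 2 (auxW H (fun _ => q) (H.mulVec fun j => (ω j).1)) -
        ∑ ω' : Fin n → ZMod 2 × Y, (∏ i, q (ω' i).1 * w (ω' i).1 (ω' i).2) *
          Real.logb 2 (auxW H (fun _ => q) (H.mulVec fun j => (ω' j).1))))
      ≤ Real.exp (n * (l ^ 2 * (Real.logb 2 R) ^ 2 / 8)) := by
  refine aux_mcd_h n (fun u : ZMod 2 × Y => q u.1 * w u.1 u.2)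
    (fun u => mul_nonneg (hq0 _) (hw0 _ _)) (auxQW_sum q w hq1 hw1) (Real.logb 2 R)
    (fun ω => Real.logb 2 (auxW H (fun _ => q) (H.mulVec fun j => (ω j).1))) ?_ l
  intro i ω v hω hv
  have e : (fun j => (Function.update ω i v j).1) = Function.update (fun j => (ω j).1) i v.1 := by
    funext j
    by_cases hj : j = i
    · subst hj; simp
    · simp [hj]
  simp only [e]
  have hqp : ∀ u : ZMod 2 × Y, 0 < q u.1 * w u.1 u.2 → 0 < q u.1 := fun u hu =>
    pos_of_mul_pos_left hu (hw0 _ _)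
  have hz : ∀ z, q z ≤ R * q (z + (v.1 - (ω i).1)) := by
    intro z
    by_cases hd : v.1 = (ω i).1
    · rw [hd, sub_self, add_zero]
      nlinarith [hq0 z]
    · have hall : ∀ z, 0 < q z := by
        intro z
        have : z = v.1 ∨ z = (ω i).1 := by
          generalize v.1 = a at *
          generalize (ω i).1 = c at *
          clear * - hd
          revert z a c; decide
        rcases this with h | h <;> rw [h]
        · exact hqp _ hv
        · exact hqp _ (hω i)
      exact hR _ _ (hall _) (hall _)
  refine auxW_logdiff H (fun _ => q) (fun _ => q) (fun _ => hq0) (fun _ => hq0) i R (by linarith)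
    (fun _ _ => rfl) (fun j => (ω j).1) v.1 (fun j => hqp _ (hω j)) ?_ hz hz
  intro j
  by_cases hj : j = i
  · subst hj; simpa using hqp _ hv
  · simpa [hj] using hqp _ (hω j)

theorem aux_MU_A {Y : Type*} [Fintype Y] (r n : ℕ)
    (H : Matrix (Fin r) (Fin n) (ZMod 2))
    (q : ZMod 2 → ℝ) (hq0 : ∀ a, 0 ≤ q a) (hq1 : ∑ a, q a = 1)
    (w : ZMod 2 → Y → ℝ) (hw0 : ∀ a b, 0 ≤ w a b) (hw1 : ∀ a, ∑ b, w a b = 1)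
    (R : ℝ) (hR1 : 1 ≤ R)
    (hR : ∀ a a' b b', 0 < q a * w a b → 0 < q a' * w a' b' →
      ∀ z, auxPost q w b z ≤ R * auxPost q w b' (z + (a' - a))) (l : ℝ) :
    ∑ ω : Fin n → ZMod 2 × Y, (∏ i, q (ω i).1 * w (ω i).1 (ω i).2) *
      Real.exp (l * (Real.logb 2 (auxW H (fun j => auxPost q w (ω j).2) (H.mulVec fun j => (ω j).1)) -
        ∑ ω' : Fin n → ZMod 2 × Y, (∏ i, q (ω' i).1 * w (ω' i).1 (ω' i).2) *
          Real.logb 2 (auxW H (fun j => auxPost q w (ω' j).2) (H.mulVec fun j => (ω' j).1))))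
      ≤ Real.exp (n * (l ^ 2 * (Real.logb 2 R) ^ 2 / 8)) := by
  refine aux_mcd_h n (fun u : ZMod 2 × Y => q u.1 * w u.1 u.2)
    (fun u => mul_nonneg (hq0 _) (hw0 _ _)) (auxQW_sum q w hq1 hw1) (Real.logb 2 R)
    (fun ω => Real.logb 2 (auxW H (fun j => auxPost q w (ω j).2) (H.mulVec fun j => (ω j).1))) ?_ l
  intro i ω v hω hv
  have e : (fun j => (Function.update ω i v j).1) = Function.update (fun j => (ω j).1) i v.1 := by
    funext j
    by_cases hj : j = i
    · subst hj; simp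
    · simp [hj]
  simp only [e]
  have hs : v.1 - (ω i).1 = (ω i).1 - v.1 := by
    generalize v.1 = a
    generalize (ω i).1 = c
    revert a c; decide
  refine auxW_logdiff H (fun j => auxPost q w (ω j).2)
    (fun j => auxPost q w (Function.update ω i v j).2)
    (fun j z => auxPost_nonneg q w hq0 hw0 _ _) (fun j z => auxPost_nonneg q w hq0 hw0 _ _)
    i R (by linarith)
    (fun j hj => by simp [hj]) (fun j => (ω j).1) v.1
    (fun j => auxPost_pos q w hq0 hw0 _ _ (hω j)) ?_ ?_ ?_
  · intro j
    by_cases hj : j = i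
    · subst hj; simpa using auxPost_pos q w hq0 hw0 _ _ hv
    · simpa [hj] using auxPost_pos q w hq0 hw0 _ _ (hω j)
  · intro z
    simpa using hR _ _ _ _ (hω i) hv z
  · intro z
    rw [hs]
    simpa using hR _ _ _ _ hv (hω i) z

theorem aux_stage2 {r n : ℕ} (H : Matrix (Fin r) (Fin n) (ZMod 2))
    (p : Fin n → ZMod 2 → ℝ) (hp : ∀ j z, 0 ≤ p j z) (hp1 : ∀ j, ∑ z, p j z = 1)
    (K : ℝ) (hK1 : 1 ≤ K) (hK : ∀ j a, 0 < p j a → -Real.logb 2 (p j a) ≤ K) (l : ℝ) :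
    ∑ x : Fin n → ZMod 2, (∏ j, p j (x j)) *
      Real.exp (l * (Real.logb 2 (auxW H p (H.mulVec x)) -
        ∑ x' : Fin n → ZMod 2, (∏ j, p j (x' j)) * Real.logb 2 (auxW H p (H.mulVec x'))))
      ≤ Real.exp (n * (l ^ 2 * (K ^ 2 - 1) / 8)) := by
  have := aux_mcd (l ^ 2 * (K ^ 2 - 1) / 8) n p hp hp1
    (fun j => |l| * |Real.logb 2 (p j 0) - Real.logb 2 (p j 1)|)
    (fun j g hg => aux_bern (p j) (hp j) (by rw [← aux_sum_zmod2]; exact hp1 j) K l hK1 (hK j) g hg)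
    (fun x => l * Real.logb 2 (auxW H p (H.mulVec x))) (by
      intro i x v hx hv
      rw [← mul_sub, abs_mul]
      refine mul_le_mul_of_nonneg_left ?_ (abs_nonneg _)
      by_cases hd : v = x i
      · subst hd; simp
      · have hpos : ∀ z, 0 < p i z := by
          intro z
          have : z = v ∨ z = x i := by
            generalize x i = c at *
            clear * - hd
            revert z v c; decide
          rcases this with h | h <;> rw [h]
          · exact hv
          · exact hx i
        set D := |Real.logb 2 (p i 0) - Real.logb 2 (p i 1)| with hD
        have hD2 : ∀ a c, p i a ≤ (2:ℝ) ^ D * p i c := by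
          intro a c
          have h1 : Real.logb 2 (p i a) ≤ D + Real.logb 2 (p i c) := by
            have ha : a = 0 ∨ a = 1 := by revert a; decide
            have hc : c = 0 ∨ c = 1 := by revert c; decide
            have := abs_le.1 hD.ge
            have h0 : 0 ≤ D := abs_nonneg _
            rcases ha with rfl | rfl <;> rcases hc with rfl | rfl <;> linarith [this.1, this.2]
          rw [Real.logb_le_iff_le_rpow (by norm_num) (hpos a), Real.rpow_add (by norm_num),
            Real.rpow_logb (by norm_num) (by norm_num) (hpos c)] at h1
          exact h1
        have := auxW_logdiff H p p hp hp i ((2:ℝ) ^ D) (by positivity) (fun _ _ => rfl) x v hx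
          (by
            intro j
            by_cases hj : j = i
            · subst hj; simpa using hv
            · simpa [hj] using hx j) (fun z => hD2 _ _) (fun z => hD2 _ _)
        rwa [Real.logb_rpow (by norm_num) (by norm_num)] at this)
  refine le_trans (le_of_eq ?_) this
  refine Finset.sum_congr rfl fun ω _ => ?_
  congr 2
  rw [mul_sub, Finset.mul_sum]
  congr 1
  refine Finset.sum_congr rfl fun ω _ => ?_
  ring

theorem aux_MU_B {Y : Type*} [Fintype Y] (r n : ℕ)
    (H : Matrix (Fin r) (Fin n) (ZMod 2))
    (q : ZMod 2 → ℝ) (hq0 : ∀ a, 0 ≤ q a) (hq1 : ∑ a, q a = 1)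
    (w : ZMod 2 → Y → ℝ) (hw0 : ∀ a b, 0 ≤ w a b) (hw1 : ∀ a, ∑ b, w a b = 1)
    (K : ℝ) (hK1 : 1 ≤ K)
    (hK : ∀ b a, 0 < auxPost q w b a → -Real.logb 2 (auxPost q w b a) ≤ K) (l : ℝ) :
    ∑ ω : Fin n → ZMod 2 × Y, (∏ i, q (ω i).1 * w (ω i).1 (ω i).2) *
      Real.exp (l * (Real.logb 2 (auxW H (fun j => auxPost q w (ω j).2) (H.mulVec fun j => (ω j).1)) -
        ∑ ω' : Fin n → ZMod 2 × Y, (∏ i, q (ω' i).1 * w (ω' i).1 (ω' i).2) *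
          Real.logb 2 (auxW H (fun j => auxPost q w (ω' j).2) (H.mulVec fun j => (ω' j).1))))
      ≤ Real.exp (n * (l ^ 2 * K ^ 2 / 8)) := by
  set G : (Fin n → Y) → ℝ := fun y => ∑ x : Fin n → ZMod 2, (∏ j, auxPost q w (y j) (x j)) *
    Real.logb 2 (auxW H (fun j => auxPost q w (y j)) (H.mulVec x)) with hG
  have hEU : ∑ ω' : Fin n → ZMod 2 × Y, (∏ i, q (ω' i).1 * w (ω' i).1 (ω' i).2) *
          Real.logb 2 (auxW H (fun j => auxPost q w (ω' j).2) (H.mulVec fun j => (ω' j).1))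
      = ∑ y : Fin n → Y, (∏ j, auxT q w (y j)) * G y := by
    rw [aux_sum_pair, Finset.sum_comm]
    refine Finset.sum_congr rfl fun y _ => ?_
    rw [hG]
    simp only [Finset.mul_sum]
    refine Finset.sum_congr rfl fun x _ => ?_
    simp only [auxPost_mul q w hq0 hw0, Finset.prod_mul_distrib]
    ring
  rw [hEU]
  set EG := ∑ y : Fin n → Y, (∏ j, auxT q w (y j)) * G y
  have st1 := aux_mcd_h n (auxT q w) (auxT_nonneg q w hq0 hw0) (auxT_sum q w hq1 hw1) 1 G (by
    intro i y v hy hv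
    have hv' : ∀ j, 0 < auxT q w (Function.update y i v j) := by
      intro j
      by_cases hj : j = i
      · subst hj; simpa using hv
      · simpa [hj] using hy j
    exact aux_entropy_diff H (fun j => auxPost q w (y j))
      (fun j => auxPost q w (Function.update y i v j))
      (fun j z => auxPost_nonneg q w hq0 hw0 _ _) (fun j => auxPost_sum q w _ (hy j))
      (fun j z => auxPost_nonneg q w hq0 hw0 _ _) (fun j => auxPost_sum q w _ (hv' j)) i
      (fun j hj => by simp [hj])) l
  rw [aux_sum_pair, Finset.sum_comm]
  calc _ ≤ ∑ y : Fin n → Y, ((∏ j, auxT q w (y j)) * Real.exp (l * (G y - EG))) *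
        Real.exp (n * (l ^ 2 * (K ^ 2 - 1) / 8)) := by
        refine Finset.sum_le_sum fun y _ => ?_
        have hnn : 0 ≤ ∏ j, auxT q w (y j) := Finset.prod_nonneg fun j _ => auxT_nonneg q w hq0 hw0 _
        have e : (∑ x : Fin n → ZMod 2, (∏ i, q (x i) * w (x i) (y i)) *
            Real.exp (l * (Real.logb 2 (auxW H (fun j => auxPost q w (y j)) (H.mulVec x)) - EG)))
            = ((∏ j, auxT q w (y j)) * Real.exp (l * (G y - EG))) *
              ∑ x : Fin n → ZMod 2, (∏ j, auxPost q w (y j) (x j)) *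
                Real.exp (l * (Real.logb 2 (auxW H (fun j => auxPost q w (y j)) (H.mulVec x)) - G y)) := by
          rw [Finset.mul_sum]
          refine Finset.sum_congr rfl fun x _ => ?_
          simp only [auxPost_mul q w hq0 hw0, Finset.prod_mul_distrib]
          rw [show l * (Real.logb 2 (auxW H (fun j => auxPost q w (y j)) (H.mulVec x)) - EG) =
            l * (G y - EG) + l * (Real.logb 2 (auxW H (fun j => auxPost q w (y j)) (H.mulVec x)) - G y)
            by ring, Real.exp_add]
          ring
        refine e.trans_le ?_
        rcases hnn.lt_or_eq with h | h
        · refine mul_le_mul_of_nonneg_left ?_ (mul_nonneg hnn (Real.exp_pos _).le)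
          have hy : ∀ j, 0 < auxT q w (y j) := by
            intro j
            rcases (auxT_nonneg q w hq0 hw0 (y j)).lt_or_eq with h' | h'
            · exact h'
            · exact absurd (Finset.prod_eq_zero (Finset.mem_univ j) h'.symm) h.ne'
          exact aux_stage2 H (fun j => auxPost q w (y j))
            (fun j z => auxPost_nonneg q w hq0 hw0 _ _) (fun j => auxPost_sum q w _ (hy j)) K hK1
            (fun j a ha => hK _ _ ha) l
        · rw [← h]; simp
    _ ≤ Real.exp (n * (l ^ 2 * 1 ^ 2 / 8)) * Real.exp (n * (l ^ 2 * (K ^ 2 - 1) / 8)) := by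
        rw [← Finset.sum_mul]
        exact mul_le_mul_of_nonneg_right st1 (Real.exp_pos _).le
    _ = _ := by
        rw [← Real.exp_add]; congr 1; ring


theorem aux_MU {Y : Type*} [Fintype Y] (r n : ℕ)
    (H : Matrix (Fin r) (Fin n) (ZMod 2))
    (q : ZMod 2 → ℝ) (hq0 : ∀ a, 0 ≤ q a) (hq1 : ∑ a, q a = 1)
    (w : ZMod 2 → Y → ℝ) (hw0 : ∀ a b, 0 ≤ w a b) (hw1 : ∀ a, ∑ b, w a b = 1)
    (Mxqw Mnqw Mxt Mnt : ℝ) (p1 : 0 < Mxqw) (p2 : 0 < Mnqw) (p3 : 0 < Mxt) (p4 : 0 < Mnt)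
    (o1 : Mnqw ≤ Mxqw) (o2 : Mnt ≤ Mxt)
    (b1 : ∀ a b, 0 < q a * w a b → q a * w a b ≤ Mxqw)
    (b2 : ∀ a b, 0 < q a * w a b → Mnqw ≤ q a * w a b)
    (b3 : ∀ b, 0 < auxT q w b → auxT q w b ≤ Mxt)
    (b4 : ∀ b, 0 < auxT q w b → Mnt ≤ auxT q w b) (l : ℝ) :
    ∑ ω : Fin n → ZMod 2 × Y, (∏ i, q (ω i).1 * w (ω i).1 (ω i).2) *
      Real.exp (l * (Real.logb 2 (auxW H (fun j => auxPost q w (ω j).2) (H.mulVec fun j => (ω j).1)) -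
        ∑ ω' : Fin n → ZMod 2 × Y, (∏ i, q (ω' i).1 * w (ω' i).1 (ω' i).2) *
          Real.logb 2 (auxW H (fun j => auxPost q w (ω' j).2) (H.mulVec fun j => (ω' j).1))))
      ≤ Real.exp (n * (l ^ 2 * (Real.logb 2 ((Mxqw / Mnqw) * (Mxt / Mnt))) ^ 2 / 8)) := by
  have hR1 : 1 ≤ (Mxqw / Mnqw) * (Mxt / Mnt) :=
    one_le_mul_of_one_le_of_one_le ((one_le_div p2).2 o1) ((one_le_div p4).2 o2)
  have hTpos : ∀ a b, 0 < q a * w a b → 0 < auxT q w b := fun a b h =>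
    h.trans_le (auxT_ge q w hq0 hw0 a b)
  by_cases hov : ∀ a b, 0 < q a * w a b → ∀ z, 0 < q z * w z b
  · refine aux_MU_A r n H q hq0 hq1 w hw0 hw1 _ hR1 ?_ l
    intro a a' b b' h h' z
    have c1 := b1 z b (hov a b h z)
    have c2 := b2 (z + (a' - a)) b' (hov a' b' h' _)
    have c3 := b3 b' (hTpos _ _ h')
    have c4 := b4 b (hTpos _ _ h)
    have t' := hTpos _ _ h'
    calc auxPost q w b z ≤ Mxqw / Mnt := by
          unfold auxPost
          exact div_le_div₀ p1.le c1 p4 c4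
      _ = Mxqw / Mnqw * (Mxt / Mnt) * (Mnqw / Mxt) := by field_simp
      _ ≤ _ := by
          refine mul_le_mul_of_nonneg_left ?_ (by linarith)
          unfold auxPost
          exact div_le_div₀ (p2.le.trans c2) c2 t' c3
  by_cases hsi : ∀ a b, 0 < q a * w a b → ∀ z, z ≠ a → q z * w z b = 0
  · refine aux_MU_A r n H q hq0 hq1 w hw0 hw1 _ hR1 ?_ l
    have hpo : ∀ a b, 0 < q a * w a b → auxPost q w b a = 1 := by
      intro a b h
      have := auxPost_sum q w b (hTpos a b h)
      rwa [Finset.sum_eq_single a (fun z _ hz => by unfold auxPost; rw [hsi a b h z hz, zero_div])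
        (by simp)] at this
    intro a a' b b' h h' z
    by_cases hz : z = a
    · subst hz
      rw [hpo _ _ h, add_sub_cancel, hpo _ _ h']; linarith
    · have : auxPost q w b z = 0 := by unfold auxPost; rw [hsi a b h z hz, zero_div]
      rw [this]
      exact mul_nonneg (by linarith) (auxPost_nonneg q w hq0 hw0 _ _)
  push Not at hov hsi
  obtain ⟨a0, d0, h0, z0, hz0⟩ := hov
  obtain ⟨a1, d1, h1, z1, hz1, hz1'⟩ := hsi
  have hnn : ∀ a b, 0 ≤ q a * w a b := fun a b => mul_nonneg (hq0 a) (hw0 a b)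
  have hz0' : q z0 * w z0 d0 = 0 := le_antisymm hz0 (hnn _ _)
  have hMM : Mnt ≤ Mxqw := by
    refine (b4 d0 (hTpos _ _ h0)).trans (le_trans (le_of_eq ?_) (b1 a0 d0 h0))
    have hne : z0 ≠ a0 := by rintro rfl; linarith
    unfold auxT
    refine Finset.sum_eq_single a0 (fun z _ hz => ?_) (by simp)
    have : z = z0 := by
      clear * - hz hne
      revert z z0 a0; decide
    rw [this, hz0']
  have hinv : ∀ b a, 0 < auxPost q w b a → 1 / ((Mxqw / Mnqw) * (Mxt / Mnt)) ≤ auxPost q w b a := by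
    intro b a h
    have hqw : 0 < q a * w a b := by
      rcases (hnn a b).lt_or_eq with h' | h'
      · exact h'
      · unfold auxPost at h; rw [← h', zero_div] at h; exact absurd h (lt_irrefl _)
    have t := hTpos _ _ hqw
    calc 1 / ((Mxqw / Mnqw) * (Mxt / Mnt)) = (Mnt / Mxqw) * (Mnqw / Mxt) := by field_simp
      _ ≤ 1 * (Mnqw / Mxt) := by
        refine mul_le_mul_of_nonneg_right ((div_le_one p1).2 hMM) (by positivity)
      _ ≤ _ := by
        rw [one_mul]
        unfold auxPost
        exact div_le_div₀ hqw.le (b2 a b hqw) t (b3 b t)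
  have hR0 : 0 < (Mxqw / Mnqw) * (Mxt / Mnt) := by linarith
  have hR2 : 2 ≤ (Mxqw / Mnqw) * (Mxt / Mnt) := by
    have q1 := auxPost_pos q w hq0 hw0 d1 a1 h1
    have q2 := auxPost_pos q w hq0 hw0 d1 z1 (lt_of_le_of_ne (hnn _ _) (Ne.symm hz1'))
    have s := auxPost_sum q w d1 (hTpos _ _ h1)
    rw [aux_sum_zmod2] at s
    have hall : ∀ z, 0 < auxPost q w d1 z := by
      intro z
      have : z = a1 ∨ z = z1 := by
        clear * - hz1
        revert z z1 a1; decide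
      rcases this with h | h <;> rw [h]
      · exact q1
      · exact q2
    have i0 := hinv d1 0 (hall 0)
    have i1 := hinv d1 1 (hall 1)
    have : 1 / ((Mxqw / Mnqw) * (Mxt / Mnt)) ≤ 1 / 2 := by linarith
    exact (one_div_le_one_div hR0 (by norm_num)).1 this
  refine aux_MU_B r n H q hq0 hq1 w hw0 hw1 _ ?_ ?_ l
  · rw [Real.le_logb_iff_rpow_le (by norm_num) hR0]; simpa using hR2
  · intro b a h
    have := Real.logb_le_logb_of_le (b := 2) (by norm_num) (by positivity) (hinv b a h)
    rw [one_div, Real.logb_inv] at this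
    linarith

theorem aux_pSY {Y : Type*} [Fintype Y] {r n : ℕ}
    (H : Matrix (Fin r) (Fin n) (ZMod 2))
    (q : ZMod 2 → ℝ) (hq0 : ∀ a, 0 ≤ q a)
    (w : ZMod 2 → Y → ℝ) (hw0 : ∀ a b, 0 ≤ w a b) (s : Fin r → ZMod 2) (y : Fin n → Y) :
    pSY H q w s y = tn q w y * auxW H (fun j => auxPost q w (y j)) s := by
  unfold pSY tn auxW
  rw [Finset.mul_sum]
  refine Finset.sum_congr rfl fun z _ => ?_
  split_ifs
  · rw [← Finset.prod_mul_distrib, ← Finset.prod_mul_distrib]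
    exact Finset.prod_congr rfl fun j _ => auxPost_mul q w hq0 hw0 _ _
  · simp

theorem aux_infoDens {Y : Type*} [Fintype Y] {r n : ℕ}
    (H : Matrix (Fin r) (Fin n) (ZMod 2))
    (q : ZMod 2 → ℝ) (hq0 : ∀ a, 0 ≤ q a)
    (w : ZMod 2 → Y → ℝ) (hw0 : ∀ a b, 0 ≤ w a b) (x : Fin n → ZMod 2) (y : Fin n → Y)
    (h : ∀ j, 0 < q (x j) * w (x j) (y j)) :
    infoDens H q w (H.mulVec x) y =
      Real.logb 2 (auxW H (fun j => auxPost q w (y j)) (H.mulVec x)) -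
      Real.logb 2 (auxW H (fun _ => q) (H.mulVec x)) := by
  have t : 0 < tn q w y := Finset.prod_pos fun j _ => (h j).trans_le (auxT_ge q w hq0 hw0 _ _)
  have u : 0 < auxW H (fun j => auxPost q w (y j)) (H.mulVec x) :=
    auxW_pos H _ (fun j z => auxPost_nonneg q w hq0 hw0 _ _) x
      (fun j => auxPost_pos q w hq0 hw0 _ _ (h j))
  have v : 0 < auxW H (fun _ => q) (H.mulVec x) :=
    auxW_pos H _ (fun _ => hq0) x (fun j => pos_of_mul_pos_left (h j) (hw0 _ _))
  have e : pS H q (H.mulVec x) = auxW H (fun _ => q) (H.mulVec x) := rfl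
  unfold infoDens
  rw [aux_pSY H q hq0 w hw0, e, ← Real.logb_div u.ne' v.ne']
  congr 1
  field_simp



open scoped Classical in
/-- Concentration of the information density for the
parity-check ensemble.  With `γ = (1/n) I(S;Yⁿ) + ε`, `ε > 0`, the probability
`P(i(S;Yⁿ) > nγ) ≤ exp(−2nε²/d)` where `d = (log₂(β_{q,w} β_q β_t))²` and the
`β`'s are the max/min support ratios `Mx…/Mn…` of `q·w`, `q`, `t`. -/
theorem infoDens_concentration {Y : Type*} [Fintype Y] (r n : ℕ)
    (H : Matrix (Fin r) (Fin n) (ZMod 2))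
    (q : ZMod 2 → ℝ) (hq0 : ∀ a, 0 ≤ q a) (hq1 : ∑ a, q a = 1)
    (w : ZMod 2 → Y → ℝ) (hw0 : ∀ a b, 0 ≤ w a b) (hw1 : ∀ a, ∑ b, w a b = 1)
    (Mxqw Mnqw Mxq Mnq Mxt Mnt : ℝ)
    (hMxqw : IsGreatest {v : ℝ | ∃ a b, 0 < q a * w a b ∧ v = q a * w a b} Mxqw)
    (hMnqw : IsLeast {v : ℝ | ∃ a b, 0 < q a * w a b ∧ v = q a * w a b} Mnqw)
    (hMxq : IsGreatest {v : ℝ | ∃ a, 0 < q a ∧ v = q a} Mxq)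
    (hMnq : IsLeast {v : ℝ | ∃ a, 0 < q a ∧ v = q a} Mnq)
    (hMxt : IsGreatest {v : ℝ | ∃ b, 0 < ∑ a, q a * w a b ∧ v = ∑ a, q a * w a b} Mxt)
    (hMnt : IsLeast {v : ℝ | ∃ b, 0 < ∑ a, q a * w a b ∧ v = ∑ a, q a * w a b} Mnt)
    (ε : ℝ) (hε : 0 < ε) (hn : 0 < n) :
    ∑ x : Fin n → ZMod 2, ∑ y : Fin n → Y,
        (if mutInfoSY H q w + n * ε < infoDens H q w (H.mulVec x) y then
          (∏ j, q (x j)) * ∏ j, w (x j) (y j) else 0)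
      ≤ Real.exp (-(2 * n * ε ^ 2) /
          (Real.logb 2 ((Mxqw / Mnqw) * (Mxq / Mnq) * (Mxt / Mnt))) ^ 2) := by
  have x1 : ∀ a b, 0 < q a * w a b → q a * w a b ≤ Mxqw := fun a b h => hMxqw.2 ⟨a, b, h, rfl⟩
  have x2 : ∀ a b, 0 < q a * w a b → Mnqw ≤ q a * w a b := fun a b h => hMnqw.2 ⟨a, b, h, rfl⟩
  have x3 : ∀ b, 0 < auxT q w b → auxT q w b ≤ Mxt := fun b h => hMxt.2 ⟨b, h, rfl⟩
  have x4 : ∀ b, 0 < auxT q w b → Mnt ≤ auxT q w b := fun b h => hMnt.2 ⟨b, h, rfl⟩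
  have x5 : ∀ a, 0 < q a → q a ≤ Mxq := fun a h => hMxq.2 ⟨a, h, rfl⟩
  have x6 : ∀ a, 0 < q a → Mnq ≤ q a := fun a h => hMnq.2 ⟨a, h, rfl⟩
  have p1 : 0 < Mxqw := by obtain ⟨a, b, h, e⟩ := hMxqw.1; rw [e]; exact h
  have p2 : 0 < Mnqw := by obtain ⟨a, b, h, e⟩ := hMnqw.1; rw [e]; exact h
  have p3 : 0 < Mxt := by obtain ⟨b, h, e⟩ := hMxt.1; rw [e]; exact h
  have p4 : 0 < Mnt := by obtain ⟨b, h, e⟩ := hMnt.1; rw [e]; exact h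
  have p5 : 0 < Mxq := by obtain ⟨b, h, e⟩ := hMxq.1; rw [e]; exact h
  have p6 : 0 < Mnq := by obtain ⟨b, h, e⟩ := hMnq.1; rw [e]; exact h
  have o1 : Mnqw ≤ Mxqw := hMnqw.2 hMxqw.1
  have o2 : Mnt ≤ Mxt := hMnt.2 hMxt.1
  have o3 : Mnq ≤ Mxq := hMnq.2 hMxq.1
  have hRK : 1 ≤ (Mxqw / Mnqw) * (Mxt / Mnt) :=
    one_le_mul_of_one_le_of_one_le ((one_le_div p2).2 o1) ((one_le_div p4).2 o2)
  have hRb : 1 ≤ Mxq / Mnq := (one_le_div p6).2 o3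
  have hsplit : Real.logb 2 ((Mxqw / Mnqw) * (Mxq / Mnq) * (Mxt / Mnt)) =
      Real.logb 2 ((Mxqw / Mnqw) * (Mxt / Mnt)) + Real.logb 2 (Mxq / Mnq) := by
    rw [← Real.logb_mul (by positivity) (by positivity)]
    congr 1; ring
  set U : (Fin n → ZMod 2 × Y) → ℝ := fun ω =>
    Real.logb 2 (auxW H (fun j => auxPost q w (ω j).2) (H.mulVec fun j => (ω j).1)) with hUd
  set V : (Fin n → ZMod 2 × Y) → ℝ := fun ω =>
    Real.logb 2 (auxW H (fun _ => q) (H.mulVec fun j => (ω j).1)) with hVd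
  set J : (Fin n → ZMod 2 × Y) → ℝ := fun ω => ∏ i, q (ω i).1 * w (ω i).1 (ω i).2 with hJd
  have hJ0 : ∀ ω, 0 ≤ J ω := fun ω => Finset.prod_nonneg fun j _ => mul_nonneg (hq0 _) (hw0 _ _)
  have hJ1 : ∑ ω, J ω = 1 := by
    rw [hJd, ← Fintype.prod_sum (fun (_ : Fin n) (u : ZMod 2 × Y) => q u.1 * w u.1 u.2)]
    simp [auxQW_sum q w hq1 hw1]
  have hdens : ∀ x y, (∏ j, q (x j)) * (∏ j, w (x j) (y j)) ≠ 0 →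
      infoDens H q w (H.mulVec x) y = U (fun j => (x j, y j)) - V (fun j => (x j, y j)) := by
    intro x y h
    rw [← Finset.prod_mul_distrib, Finset.prod_ne_zero_iff] at h
    exact aux_infoDens H q hq0 w hw0 x y fun j =>
      lt_of_le_of_ne (mul_nonneg (hq0 _) (hw0 _ _)) (Ne.symm (h j (Finset.mem_univ j)))
  have hJxy : ∀ (x : Fin n → ZMod 2) (y : Fin n → Y), J (fun j => (x j, y j)) = (∏ j, q (x j)) * (∏ j, w (x j) (y j)) := by
    intro x y
    simp only [hJd, Finset.prod_mul_distrib]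
  have hmut : mutInfoSY H q w = (∑ ω, J ω * U ω) - ∑ ω, J ω * V ω := by
    rw [← Finset.sum_sub_distrib, aux_sum_pair]
    unfold mutInfoSY
    refine Finset.sum_congr rfl fun x _ => Finset.sum_congr rfl fun y _ => ?_
    rw [← mul_sub, hJxy]
    by_cases h : (∏ j, q (x j)) * (∏ j, w (x j) (y j)) = 0
    · rw [h]; simp
    · rw [hdens x y h]
  have main := aux_final J U V hJ0 hJ1 n (Nat.cast_nonneg n)
    (Real.logb 2 ((Mxqw / Mnqw) * (Mxt / Mnt))) (Real.logb 2 (Mxq / Mnq))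
    (Real.logb_nonneg (by norm_num) hRK) (Real.logb_nonneg (by norm_num) hRb)
    (aux_MU r n H q hq0 hq1 w hw0 hw1 Mxqw Mnqw Mxt Mnt p1 p2 p3 p4 o1 o2 x1 x2 x3 x4)
    (aux_MV r n H q hq0 hq1 w hw0 hw1 _ hRb (by
      intro a a' h h'
      calc q a ≤ Mxq := x5 a h
        _ = Mxq / Mnq * Mnq := by field_simp
        _ ≤ _ := mul_le_mul_of_nonneg_left (x6 a' h') (by positivity))) ε hε
  rw [hsplit, hmut]
  refine le_trans (le_of_eq ?_) main
  refine Eq.trans ?_ (aux_sum_pair _).symm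
  refine Finset.sum_congr rfl fun x _ => ?_
  refine Finset.sum_congr rfl fun y _ => ?_
  simp only [hJxy]
  by_cases h : (∏ j, q (x j)) * (∏ j, w (x j) (y j)) = 0
  · simp only [h, ite_self]
  · rw [hdens x y h]
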